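/- arXiv:1305.5229 — 3 statements merged into one kernel-verified Lean document; each statement's English description precedes it below -/
import Mathlib

section
/- For every r with 0 < r < 1/2, there is no proper 2-coloring of the annulus A_r: for every function c : A_r → Fin 2 there exist points p, q ∈ A_r with ‖p - q‖ = 1 and c(p) = c(q). -/
def annulus (r : ℝ) : Set ℂ := {p : ℂ | 1 / 2 - r ≤ ‖p‖ ∧ ‖p‖ ≤ 1 / 2 + r}

theorem annulus_not_two_colorable (r : ℝ) (hr0 : 0 < r) (hr1 : r < 1 / 2)
    (c : annulus r → Fin 2) :
    ∃ p q : annulus r, ‖(p : ℂ) - (q : ℂ)‖ = 1 ∧ c p = c q := by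
  by_contra! H
  let w : ℕ → ℂ := fun k => -Complex.exp ((Real.pi / (2 * k + 1 : ℝ) : ℝ) * Complex.I)
  have hw1 : ∀ k, ‖w k‖ = 1 := fun k => by
    simp only [w, norm_neg]
    exact Complex.norm_exp_ofReal_mul_I _
  have hwp : ∀ k, w k ^ (2 * k + 1) = 1 := fun k => by
    simp only [w]
    rw [Odd.neg_pow ⟨k, rfl⟩, ← Complex.exp_nat_mul]
    have h : ((2 * k + 1 : ℕ) : ℂ) * (((Real.pi / (2 * k + 1 : ℝ) : ℝ) : ℂ) * Complex.I)
        = Real.pi * Complex.I := by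
      have : (2 * (k : ℂ) + 1) ≠ 0 := by exact_mod_cast Nat.succ_ne_zero (2 * k)
      push_cast
      field_simp
    rw [h, Complex.exp_pi_mul_I, neg_neg]
  have hlim : Filter.Tendsto (fun k => 1 / ‖w k - 1‖) Filter.atTop (nhds (1 / 2)) := by
    have h0 : Filter.Tendsto (fun k : ℕ => Real.pi / (2 * k + 1 : ℝ)) Filter.atTop (nhds 0) := by
      apply Filter.Tendsto.div_atTop tendsto_const_nhds
      apply Filter.tendsto_atTop_add_const_right
      exact Filter.Tendsto.const_mul_atTop (by norm_num) tendsto_natCast_atTop_atTop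
    have hc : Continuous (fun t : ℝ => ‖-Complex.exp ((t : ℂ) * Complex.I) - 1‖) := by fun_prop
    have h1 := (hc.tendsto 0).comp h0
    have h2 : ‖-Complex.exp (((0 : ℝ) : ℂ) * Complex.I) - 1‖ = 2 := by norm_num
    rw [h2] at h1
    exact Filter.Tendsto.div tendsto_const_nhds h1 (by norm_num)
  obtain ⟨k, hk1, hk0⟩ := ((hlim.eventually (gt_mem_nhds (show (1 / 2 : ℝ) < 1 / 2 + r by linarith))).and
    (hlim.eventually (lt_mem_nhds (show (0 : ℝ) < 1 / 2 by norm_num)))).exists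
  set ρ : ℝ := 1 / ‖w k - 1‖ with hρ
  have hd : 0 < ‖w k - 1‖ := by
    rw [hρ] at hk0
    exact one_div_pos.mp hk0
  have hd2 : ‖w k - 1‖ ≤ 2 := by
    have := norm_sub_le (w k) 1
    rw [hw1, norm_one] at this
    linarith
  have hρ2 : 1 / 2 ≤ ρ := one_div_le_one_div_of_le hd hd2
  have hn : ∀ j : ℕ, ‖(ρ : ℂ) * w k ^ j‖ = ρ := fun j => by
    rw [norm_mul, norm_pow, hw1, one_pow, mul_one, Complex.norm_real, Real.norm_of_nonneg hk0.le]
  let z : ℕ → annulus r := fun j => ⟨(ρ : ℂ) * w k ^ j, by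
    constructor <;> rw [hn] <;> linarith⟩
  have hz : ∀ j, c (z (j + 1)) ≠ c (z j) := fun j => by
    apply H
    show ‖(ρ : ℂ) * w k ^ (j + 1) - (ρ : ℂ) * w k ^ j‖ = 1
    have : (ρ : ℂ) * w k ^ (j + 1) - (ρ : ℂ) * w k ^ j = ((ρ : ℂ) * w k ^ j) * (w k - 1) := by ring
    rw [this, norm_mul, hn, hρ]
    field_simp
  have he : ∀ j, c (z (2 * j)) = c (z 0) := fun j => by
    induction j with
    | zero => rfl
    | succ j ih =>
      have a := hz (2 * j)
      have b := hz (2 * j + 1)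
      rw [← ih]
      show c (z (2 * j + 1 + 1)) = _
      omega
  have hlast : z (2 * k + 1) = z 0 := by
    apply Subtype.ext
    show (ρ : ℂ) * w k ^ (2 * k + 1) = (ρ : ℂ) * w k ^ 0
    rw [hwp, pow_zero]
  apply hz (2 * k)
  rw [hlast, he]
end

section
/- Tri-rod lemma: Let R ⊆ ℝ² and let c : ℝ² → Fin 3 be a coloring such that any two points of R at distance 1 get distinct colors. Suppose γ₁, γ₂, γ₃ : [0,1] → interior(R) are continuous paths with ‖γᵢ(t) - γⱼ(t)‖ = 1 for all t and all i ≠ j (a continuously sliding unit equilateral triangle). Then c(γ₁(0)) = c(γ₁(1)). -/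
namespace TriRod

/-- translation -/
def T (s : ℂ) (f : ℂ → ZMod 3) : ℂ → ZMod 3 := fun x => f (x + s)
/-- three-term sum; equals the square of the central difference in characteristic 3 -/
def S (a : ℂ) (f : ℂ → ZMod 3) : ℂ → ZMod 3 := fun x => f (x + a) + f x + f (x - a)
/-- central difference -/
noncomputable def dl (a : ℂ) (f : ℂ → ZMod 3) : ℂ → ZMod 3 := fun x => f (x + a / 2) - f (x - a / 2)
/-- equality on a ball -/
def EqB (R : ℝ) (f g : ℂ → ZMod 3) : Prop := ∀ x, ‖x‖ < R → f x = g x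

lemma EqB.mono {R R' : ℝ} {f g : ℂ → ZMod 3} (h : EqB R f g) (hR : R' ≤ R) : EqB R' f g :=
  fun x hx => h x (lt_of_lt_of_le hx hR)

lemma EqB.symm {R : ℝ} {f g : ℂ → ZMod 3} (h : EqB R f g) : EqB R g f :=
  fun x hx => (h x hx).symm

lemma EqB.trans {R : ℝ} {f g k : ℂ → ZMod 3} (h : EqB R f g) (h' : EqB R g k) : EqB R f k :=
  fun x hx => (h x hx).trans (h' x hx)

lemma EqB.T {R τ : ℝ} {f g : ℂ → ZMod 3} (h : EqB R f g) {s : ℂ} (hs : ‖s‖ ≤ τ) :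
    EqB (R - τ) (T s f) (T s g) := by
  intro x hx
  apply h
  have := norm_add_le x s
  linarith

lemma EqB.S {R τ : ℝ} {f g : ℂ → ZMod 3} (h : EqB R f g) {s : ℂ} (hs : ‖s‖ ≤ τ) :
    EqB (R - τ) (S s f) (S s g) := by
  intro x hx
  have h0 := norm_nonneg s
  have h1 := norm_add_le x s
  have h2 := norm_sub_le x s
  simp only [TriRod.S]
  rw [h _ (by linarith), h x (by linarith), h (x - s) (by linarith)]

lemma EqB.dl {R τ : ℝ} {f g : ℂ → ZMod 3} (h : EqB R f g) {s : ℂ} (hs : ‖s‖ ≤ τ) :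
    EqB (R - τ) (dl s f) (dl s g) := by
  intro x hx
  have h0 := norm_nonneg s
  have h1 := norm_add_le x (s / 2)
  have h2 := norm_sub_le x (s / 2)
  have h3 : ‖s / 2‖ = ‖s‖ / 2 := by simp
  simp only [TriRod.dl]
  rw [h _ (by linarith), h (x - s / 2) (by linarith)]

lemma EqB.neg {R : ℝ} {f g : ℂ → ZMod 3} (h : EqB R f g) : EqB R (-f) (-g) :=
  fun x hx => by simp [h x hx]

lemma T_S (s a : ℂ) (f) : T s (S a f) = S a (T s f) := by
  funext x; simp only [T, S]; ring_nf
lemma T_dl (s a : ℂ) (f) : T s (dl a f) = dl a (T s f) := by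
  funext x; simp only [T, dl]; ring_nf
lemma T_T (s a : ℂ) (f) : T s (T a f) = T (s + a) f := by
  funext x; simp only [T]; ring_nf
lemma S_S (s a : ℂ) (f) : S s (S a f) = S a (S s f) := by
  funext x; simp only [S]; ring_nf
lemma dl_dl (s a : ℂ) (f) : dl s (dl a f) = dl a (dl s f) := by
  funext x; simp only [dl]; ring_nf
lemma S_neg (s : ℂ) (f) : S s (-f) = - S s f := by
  funext x; simp only [S, Pi.neg_apply]; ring_nf
lemma T_neg (s : ℂ) (f) : T s (-f) = - T s f := rfl
lemma dl_neg (s : ℂ) (f) : dl s (-f) = - dl s f := by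
  funext x; simp only [dl, Pi.neg_apply]; ring_nf

lemma three0 : (3 : ZMod 3) = 0 := rfl

lemma S_cube (a : ℂ) (f) : S a (S a (S a f)) = S (3 * a) f := by
  funext x
  simp only [S]
  have e1 : x + a + a + a = x + 3 * a := by ring
  have e2 : x - a - a - a = x - 3 * a := by ring
  have e3 : x + a + a - a = x + a := by ring
  have e5 : x + a - a = x := by ring
  have e6 : x - a + a = x := by ring
  have e7 : x - a - a + a = x - a := by ring
  simp only [e1, e2, e3, e5, e6, e7]
  linear_combination (f (x + a + a) + 2 * f (x + a) + 2 * f x + 2 * f (x - a)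
    + f (x - a - a)) * three0

lemma dl_three (a : ℂ) (f) : dl (3 * a) f = S a (dl a f) := by
  funext x
  simp only [S, dl]
  have e1 : x + 3 * a / 2 = x + a + a / 2 := by ring
  have e2 : x - 3 * a / 2 = x - a - a / 2 := by ring
  have e3 : x + a - a / 2 = x + a / 2 := by ring
  have e4 : x - a + a / 2 = x - a / 2 := by ring
  rw [e1, e2, e3, e4]; ring

lemma dl_nine (a : ℂ) (f) : dl (9 * a) f = S (3 * a) (S a (dl a f)) := by
  rw [← dl_three, ← dl_three]; congr 1; ring

/-- The core algebraic lemma. -/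
lemma core {R τ : ℝ} {Y Z : ℂ → ZMod 3} {a b s1 s3 s9 : ℂ}
    (ha : ‖3 * a‖ ≤ τ) (hb : ‖3 * b‖ ≤ τ) (h1 : ‖s1‖ ≤ τ) (h3 : ‖s3‖ ≤ τ) (h9 : ‖s9‖ ≤ τ)
    (E1 : EqB R (dl b Y) (-T s1 (dl a Z)))
    (E3 : EqB R (dl (3 * b) Y) (-T s3 (dl (3 * a) Z)))
    (E9 : EqB R (dl (9 * b) Y) (-T s9 (dl (9 * a) Z))) :
    EqB (R - 40 * τ) (T (s9 - 4 * s3 + 3 * s1) (dl (9 * a) Z)) (dl (9 * a) Z) ∧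
    EqB (R - 40 * τ) (T (s9 - 4 * s3 + 3 * s1) (dl (9 * b) Y)) (dl (9 * b) Y) := by
  have hτ : 0 ≤ τ := le_trans (norm_nonneg _) h1
  have ha' : ‖a‖ ≤ τ := by
    rw [norm_mul] at ha; norm_num at ha; have := norm_nonneg a; linarith
  have hb' : ‖b‖ ≤ τ := by
    rw [norm_mul] at hb; norm_num at hb; have := norm_nonneg b; linarith
  set K := dl a Z with hK
  have P1 : EqB (R - τ) (S a (T s3 K)) (S b (T s1 K)) := by
    have q := E1.S hb'
    rw [← dl_three, S_neg] at q
    have q2 := ((E3.mono (by linarith : R - τ ≤ R)).symm.trans q).neg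
    rw [dl_three, neg_neg, neg_neg, T_S] at q2
    exact q2
  have P3 : EqB (R - τ) (T s9 (S (3 * a) (S a K))) (S (3 * b) (T s3 (S a K))) := by
    have q := E3.S hb
    rw [dl_three b, ← dl_nine, S_neg, dl_three a] at q
    have q2 := ((E9.mono (by linarith : R - τ ≤ R)).symm.trans q).neg
    rw [dl_nine, neg_neg, neg_neg] at q2
    exact q2
  have key : ∀ {R' : ℝ} {f g}, EqB R' f g → EqB (R' - τ - τ) (S a (T s3 f)) (S a (T s3 g)) :=
    fun h => (h.T h3).S ha'
  have key' : ∀ {R' : ℝ} {f g}, EqB R' f g → EqB (R' - τ - τ) (S b (T s1 f)) (S b (T s1 g)) :=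
    fun h => (h.T h1).S hb'
  have comm : ∀ f, S a (T s3 (S b (T s1 f))) = S b (T s1 (S a (T s3 f))) := by
    intro f
    rw [T_S, T_S, T_T, T_T, S_S, add_comm]
  have P1' := (key P1)
  rw [comm] at P1'
  have P2 := P1'.trans ((key' P1))
  have P2' := key P2
  rw [comm, comm] at P2'
  have P3' := P2'.trans ((key' (key' P1)).mono (by linarith))
  have P4 := P3'.S ha'
  have f1 : S a (S a (T s3 (S a (T s3 (S a (T s3 K)))))) = T (3 * s3) (S (3 * a) (S a K)) := by
    rw [← S_cube]
    simp only [T_S, T_T]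
    have : s3 + (s3 + s3) = 3 * s3 := by ring
    rw [this]
  have f2 : S a (S b (T s1 (S b (T s1 (S b (T s1 K)))))) = T (3 * s1) (S (3 * b) (S a K)) := by
    rw [← S_cube]
    simp only [T_S, T_T]
    have : s1 + (s1 + s1) = 3 * s1 := by ring
    rw [this, S_S a b, S_S a b, S_S a b]
  rw [f1, f2] at P4
  have n31 : ‖3 * s1‖ ≤ 3 * τ := by rw [norm_mul]; norm_num; linarith
  have P5 := (P3.T n31)
  have P6 := (P4.T h3)
  rw [← T_S] at P5
  simp only [T_T] at P5 P6
  rw [add_comm s3 (3 * s1)] at P6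
  have P7 := (P5.mono (by linarith : R - 20 * τ ≤ _)).trans
    (P6.mono (by linarith : R - 20 * τ ≤ _)).symm
  have n43 : ‖-(4 * s3)‖ ≤ 4 * τ := by rw [norm_neg, norm_mul]; norm_num; linarith
  have P8 := P7.T n43
  rw [T_T, T_T, ← dl_nine] at P8
  have e1 : -(4 * s3) + (3 * s1 + s9) = s9 - 4 * s3 + 3 * s1 := by ring
  have e2 : -(4 * s3) + (s3 + 3 * s3) = 0 := by ring
  have e3 : ∀ f, T 0 f = f := fun f => by funext x; simp [T]
  rw [e1, e2, e3] at P8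
  refine ⟨P8.mono (by linarith), ?_⟩
  set w := s9 - 4 * s3 + 3 * s1 with hw
  have nw : ‖w‖ ≤ 8 * τ := by
    have q1 := norm_add_le (s9 - 4 * s3) (3 * s1)
    have q2 := norm_sub_le s9 (4 * s3)
    have q3 : ‖4 * s3‖ ≤ 4 * τ := by rw [norm_mul]; norm_num; linarith
    linarith
  have Q1 := E9.T nw
  have Q2 := (P8.T h9).neg
  rw [T_neg, T_T] at Q1
  rw [T_T, add_comm] at Q2
  exact ((Q1.mono (by linarith)).trans (Q2.mono (by linarith))).trans (E9.symm.mono (by linarith))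

noncomputable def om : ℂ := ⟨1 / 2, √3 / 2⟩

lemma om_sq : om ^ 2 = om - 1 := by
  have h : √3 * √3 = 3 := Real.mul_self_sqrt (by norm_num)
  apply Complex.ext
  · simp [om, pow_two]; nlinarith
  · simp [om, pow_two]; ring

lemma om_norm : ‖om‖ = 1 := by
  have h : √3 * √3 = 3 := Real.mul_self_sqrt (by norm_num)
  rw [Complex.norm_def, Complex.normSq_apply]
  simp only [om]
  rw [show (1 / 2 * (1 / 2) + √3 / 2 * (√3 / 2) : ℝ) = 1 by nlinarith]
  simp

lemma om_add : om + om ^ 2 = Complex.I * (√3 : ℝ) := by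
  rw [om_sq]
  apply Complex.ext
  · simp [om]; norm_num
  · simp [om]

/-- the local triangle relation -/
def Rel (X Y Z : ℂ → ZMod 3) (κ : ℂ) (R : ℝ) : Prop :=
  ∀ x, ‖x‖ < R → ∀ u : ℂ, ‖u‖ = 1 → ‖u - 1‖ < R →
    X x + Y (x + κ * (u - 1)) + Z (x + κ * om * (u - 1)) = 0

noncomputable def rr (l : ℝ) : ℝ := √(1 - l ^ 2 / 4)

lemma rr_sq {l : ℝ} (h0 : 0 ≤ l) (h1 : l ≤ 1) : rr l ^ 2 = 1 - l ^ 2 / 4 :=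
  Real.sq_sqrt (by nlinarith)

lemma rr_bounds {l : ℝ} (h0 : 0 ≤ l) (h1 : l ≤ 1) :
    0 ≤ rr l ∧ rr l ≤ 1 - l ^ 2 / 8 ∧ 1 - l ^ 2 / 4 ≤ rr l ∧
      1 - l ^ 2 / 8 - l ^ 4 / 32 ≤ rr l := by
  have hs := rr_sq h0 h1
  have hn : 0 ≤ rr l := Real.sqrt_nonneg _
  have h2 : l ^ 2 ≤ 1 := by nlinarith
  have h3 := sq_nonneg l
  have h4 : l ^ 4 = l ^ 2 * l ^ 2 := by ring
  refine ⟨hn, ?_, ?_, ?_⟩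
  · refine abs_le_of_sq_le_sq' ?_ ?_ |>.2 <;> nlinarith
  · refine abs_le_of_sq_le_sq' ?_ ?_ |>.2 <;> nlinarith
  · have hx : l ^ 2 = 4 * (l ^ 2 / 4) := by ring
    rw [h4]
    generalize l ^ 2 / 4 = x at hs hx
    rw [hx] at h2 h3 ⊢
    have hx0 : 0 ≤ x := by linarith
    have hx1 : x ≤ 1 := by linarith
    refine abs_le_of_sq_le_sq' ?_ hn |>.2
    rw [hs]
    have : x ^ 2 * ((1 + x) ^ 2) ≤ x ^ 2 * 4 := by
      apply mul_le_mul_of_nonneg_left _ (sq_nonneg x)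
      nlinarith
    nlinarith

lemma chord {X Y Z : ℂ → ZMod 3} {κ e : ℂ} {R τ l : ℝ} (h : Rel X Y Z κ R) (hκ : ‖κ‖ = 1)
    (he : ‖e‖ = 1) (he1 : ‖e - 1‖ ≤ τ / 2) (hl0 : 0 ≤ l) (hl : l ≤ τ / 2) (hl1 : l ≤ 1)
    (hτ : τ < R) :
    EqB (R - τ) (dl (κ * (Complex.I * l * e)) Y)
      (-T (κ * om ^ 2 * (e * rr l - 1)) (dl (om * (κ * (Complex.I * l * e))) Z)) ∧
      ‖e * rr l - 1‖ ≤ τ := by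
  have hb := rr_bounds hl0 hl1
  have hsq := rr_sq hl0 hl1
  have n1 : ‖(rr l : ℂ) - 1‖ ≤ l / 4 := by
    rw [← Complex.ofReal_one, ← Complex.ofReal_sub, Complex.norm_real, Real.norm_eq_abs, abs_le]
    constructor <;> nlinarith
  have n2 : ‖e * rr l - 1‖ ≤ τ / 2 + l / 4 := by
    have : e * rr l - 1 = e * (rr l - 1) + (e - 1) := by ring
    rw [this]
    refine (norm_add_le _ _).trans ?_
    rw [norm_mul, he]; linarith
  have hI : ‖Complex.I * l * e / 2‖ = l / 2 := by
    simp [he, abs_of_nonneg hl0]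
  refine ⟨?_, by linarith⟩
  intro y hy
  have hx : ‖y - κ * (e * rr l - 1)‖ < R := by
    refine (norm_sub_le _ _).trans_lt ?_
    rw [norm_mul, hκ]; linarith
  have unit : ∀ s : ℝ, s ^ 2 = l ^ 2 / 4 → ‖e * (rr l + Complex.I * s)‖ = 1 := by
    intro s hs
    rw [norm_mul, he, one_mul, Complex.norm_def, Complex.normSq_apply]
    simp only [Complex.add_re, Complex.add_im, Complex.ofReal_re, Complex.ofReal_im,
      Complex.mul_re, Complex.mul_im, Complex.I_re, Complex.I_im]
    rw [Real.sqrt_eq_one]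
    nlinarith
  have hup := unit (l / 2) (by ring)
  have hum := unit (-(l / 2)) (by ring)
  have ep : e * (rr l + Complex.I * ((l / 2 : ℝ) : ℂ)) - 1
      = (e * rr l - 1) + Complex.I * l * e / 2 := by push_cast; ring
  have em : e * (rr l + Complex.I * ((-(l / 2) : ℝ) : ℂ)) - 1
      = (e * rr l - 1) - Complex.I * l * e / 2 := by push_cast; ring
  have hp := h _ hx _ hup (by
    rw [ep]; refine (norm_add_le _ _).trans_lt ?_; rw [hI]; linarith)
  have hm := h _ hx _ hum (by
    rw [em]; refine (norm_sub_le _ _).trans_lt ?_; rw [hI]; linarith)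
  rw [ep] at hp
  rw [em] at hm
  simp only [dl, T, Pi.neg_apply]
  rw [om_sq]
  generalize e * rr l - 1 = q at *
  generalize Complex.I * l * e = d at *
  have a1 : y - κ * q + κ * (q + d / 2) = y + κ * d / 2 := by ring
  have a2 : y - κ * q + κ * (q - d / 2) = y - κ * d / 2 := by ring
  have a3 : y - κ * q + κ * om * (q + d / 2) = y + om * (κ * d) / 2 + κ * (om - 1) * q := by ring
  have a4 : y - κ * q + κ * om * (q - d / 2) = y - om * (κ * d) / 2 + κ * (om - 1) * q := by ring
  rw [a1, a3] at hp
  rw [a2, a4] at hm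
  have a5 : y + κ * (om - 1) * q + om * (κ * d) / 2
    = y + om * (κ * d) / 2 + κ * (om - 1) * q := by ring
  have a6 : y + κ * (om - 1) * q - om * (κ * d) / 2
    = y - om * (κ * d) / 2 + κ * (om - 1) * q := by ring
  rw [a5, a6]
  linear_combination hp - hm

noncomputable def eta (l : ℝ) : ℝ := 4 * rr (3 * l) - rr (9 * l) - 3 * rr l

lemma inv {X Y Z : ℂ → ZMod 3} {κ e : ℂ} {R τ l : ℝ} (h : Rel X Y Z κ R) (hκ : ‖κ‖ = 1)
    (he : ‖e‖ = 1) (he1 : ‖e - 1‖ ≤ τ / 2) (hl0 : 0 ≤ l) (hl : 9 * l ≤ τ / 2) (hl1 : 9 * l ≤ 1)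
    (hτ : τ < R) :
    EqB (R - 41 * τ) (T (-(κ * om ^ 2 * e * eta l)) (dl (9 * (om * (κ * (Complex.I * l * e)))) Z))
      (dl (9 * (om * (κ * (Complex.I * l * e)))) Z) ∧
    EqB (R - 41 * τ) (T (-(κ * om ^ 2 * e * eta l)) (dl (9 * (κ * (Complex.I * l * e))) Y))
      (dl (9 * (κ * (Complex.I * l * e))) Y) := by
  obtain ⟨E1, b1⟩ := chord h hκ he he1 hl0 (by linarith) (by linarith) hτ
  obtain ⟨E3, b3⟩ := chord (l := 3 * l) h hκ he he1 (by linarith) (by linarith) (by linarith) hτ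
  obtain ⟨E9, b9⟩ := chord (l := 9 * l) h hκ he he1 (by linarith) (by linarith) (by linarith) hτ
  have nn : ∀ z : ℂ, ‖κ * om ^ 2 * z‖ = ‖z‖ := by
    intro z; simp [hκ, om_norm]
  have nb : ‖3 * (κ * (Complex.I * l * e))‖ ≤ τ := by
    simp [hκ, he, abs_of_nonneg hl0]; linarith
  have na : ‖3 * (om * (κ * (Complex.I * l * e)))‖ ≤ τ := by
    simp [hκ, he, abs_of_nonneg hl0, om_norm]; linarith
  have c3 : κ * (Complex.I * ((3 * l : ℝ) : ℂ) * e) = 3 * (κ * (Complex.I * l * e)) := by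
    push_cast; ring
  have c9 : κ * (Complex.I * ((9 * l : ℝ) : ℂ) * e) = 9 * (κ * (Complex.I * l * e)) := by
    push_cast; ring
  have d3 : om * (3 * (κ * (Complex.I * l * e))) = 3 * (om * (κ * (Complex.I * l * e))) := by ring
  have d9 : om * (9 * (κ * (Complex.I * l * e))) = 9 * (om * (κ * (Complex.I * l * e))) := by ring
  rw [c3, d3] at E3
  rw [c9, d9] at E9
  have := core na nb (by rw [nn]; exact b1) (by rw [nn]; exact b3) (by rw [nn]; exact b9) E1 E3 E9
  have hw : κ * om ^ 2 * (e * rr (9 * l) - 1) - 4 * (κ * om ^ 2 * (e * rr (3 * l) - 1))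
      + 3 * (κ * om ^ 2 * (e * rr l - 1)) = -(κ * om ^ 2 * e * eta l) := by
    simp only [eta]; push_cast; ring
  rw [hw, show R - τ - 40 * τ = R - 41 * τ by ring] at this
  exact this

lemma special {τ : ℝ} (hτ : 0 < τ) : ∃ l : ℝ, 0 < l ∧ l < τ ∧ ∃ N : ℕ,
    N * (√3 * eta l) = 9 * l ∧ 0 < eta l := by
  have h3 : 0 < √3 := Real.sqrt_pos.mpr (by norm_num)
  have pos : ∀ l, 0 < l → l ≤ 1 / 9 → 0 < eta l := by
    intro l h0 h1
    obtain ⟨-, a1, -, -⟩ := rr_bounds h0.le (by linarith)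
    obtain ⟨-, -, -, a3⟩ := rr_bounds (l := 3 * l) (by linarith) (by linarith)
    obtain ⟨-, a9, -, -⟩ := rr_bounds (l := 9 * l) (by linarith) (by linarith)
    have hl2 : 0 < l ^ 2 := by positivity
    have hl3 : l ^ 2 ≤ 1 / 81 := by nlinarith
    have hl4 : l ^ 4 ≤ 1 / 81 * l ^ 2 := by nlinarith
    simp only [eta]
    nlinarith
  have upper : ∀ l, 0 < l → l ≤ 1 / 9 → eta l ≤ 21 * l ^ 2 := by
    intro l h0 h1
    obtain ⟨-, -, a1, -⟩ := rr_bounds h0.le (by linarith)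
    obtain ⟨-, a3, -, -⟩ := rr_bounds (l := 3 * l) (by linarith) (by linarith)
    obtain ⟨-, -, a9, -⟩ := rr_bounds (l := 9 * l) (by linarith) (by linarith)
    simp only [eta]
    nlinarith [sq_nonneg l]
  have cont : Continuous eta := by unfold eta rr; fun_prop
  set l1 := min (τ / 2) (1 / 9) with hl1
  have l1pos : 0 < l1 := by positivity
  have l1a : l1 ≤ τ / 2 := min_le_left _ _
  have l1b : l1 ≤ 1 / 9 := min_le_right _ _
  have p1 := pos l1 l1pos l1b
  obtain ⟨N, hN⟩ := exists_nat_gt (9 * l1 / (√3 * eta l1))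
  rw [div_lt_iff₀ (by positivity)] at hN
  have hN0 : (0 : ℝ) ≤ N := Nat.cast_nonneg N
  set l0 := min l1 (9 / (N * √3 * 21 + 1)) with hl0
  have hden : 0 < (N : ℝ) * √3 * 21 + 1 := by positivity
  have l0pos : 0 < l0 := by positivity
  have l0a : l0 ≤ l1 := min_le_left _ _
  have l0b : l0 ≤ 9 / (N * √3 * 21 + 1) := min_le_right _ _
  rw [le_div_iff₀ hden] at l0b
  have u0 := upper l0 l0pos (by linarith)
  have hF0 : N * (√3 * eta l0) - 9 * l0 ≤ 0 := by
    have : N * (√3 * eta l0) ≤ N * (√3 * (21 * l0 ^ 2)) := by gcongr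
    nlinarith
  have hF1 : 0 ≤ N * (√3 * eta l1) - 9 * l1 := by linarith
  have ivt := intermediate_value_Icc l0a
    (f := fun l => N * (√3 * eta l) - 9 * l) (by fun_prop)
  obtain ⟨l, ⟨hla, hlb⟩, hl⟩ := ivt ⟨hF0, hF1⟩
  refine ⟨l, by linarith, by linarith, N, by simp only at hl; linarith,
    pos l (by linarith) (by linarith)⟩

lemma cone {τ : ℝ} (hτ : 0 < τ) : ∃ σ > 0, ∀ z : ℂ, ‖z‖ < σ →
    ∃ (l1 l2 : ℝ) (e1 e2 : ℂ), 0 ≤ l1 ∧ l1 ≤ τ ∧ 0 ≤ l2 ∧ l2 ≤ τ ∧ ‖e1‖ = 1 ∧ ‖e2‖ = 1 ∧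
      ‖e1 - 1‖ ≤ τ ∧ ‖e2 - 1‖ ≤ τ ∧ z = l1 * e1 - l2 * e2 := by
  have hpt : ((τ / 2 : ℝ) : ℂ) ≠ 0 := by exact_mod_cast (by positivity : τ / 2 ≠ 0)
  have c1 : ContinuousAt (fun z : ℂ => ‖((τ / 2 : ℝ) : ℂ) + z‖) 0 := by fun_prop
  have c2 : ContinuousAt (fun z : ℂ => ‖(((τ / 2 : ℝ) : ℂ) + z) /
      ((‖((τ / 2 : ℝ) : ℂ) + z‖ : ℝ) : ℂ) - 1‖) 0 := by
    have : ((‖((τ / 2 : ℝ) : ℂ) + 0‖ : ℝ) : ℂ) ≠ 0 := by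
      rw [add_zero]; exact_mod_cast norm_ne_zero_iff.mpr hpt
    fun_prop (disch := assumption)
  have hn : ‖((τ / 2 : ℝ) : ℂ)‖ = τ / 2 := by
    rw [Complex.norm_real, Real.norm_eq_abs, abs_of_pos (by positivity)]
  have e1 := c1.eventually_lt_const (u := τ) (by simp only [add_zero]; rw [hn]; linarith)
  have e1' := c1.eventually_const_lt (u := 0) (by simp only [add_zero]; rw [hn]; linarith)
  have e2 := c2.eventually_lt_const (u := τ) (by
    simp only [add_zero]; rw [hn, div_self hpt]; simpa using hτ)
  obtain ⟨σ, hσ, H⟩ := Metric.eventually_nhds_iff.mp (e1.and (e1'.and e2))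
  refine ⟨σ, hσ, fun z hz => ?_⟩
  obtain ⟨h1, h2, h3⟩ := H (y := z) (by simpa using hz)
  refine ⟨‖((τ / 2 : ℝ) : ℂ) + z‖, τ / 2, _, 1, h2.le, h1.le, by positivity, by linarith, ?_,
    by simp, h3.le, by simpa using hτ.le, ?_⟩
  · rw [norm_div, Complex.norm_real, norm_norm, div_self h2.ne']
  · rw [mul_div_cancel₀]
    · ring
    · exact_mod_cast h2.ne'

lemma iter {f : ℂ → ZMod 3} {R : ℝ} {p : ℂ} (h : EqB R (T p f) f) (n : ℕ) :
    EqB (R - n * ‖p‖) (T (n * p) f) f := by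
  induction n with
  | zero => intro x _; simp [T]
  | succ n ih =>
    intro x hx
    push_cast at hx
    have h0 := norm_nonneg p
    have e1 := h (x + n * p) (by
      refine (norm_add_le _ _).trans_lt ?_
      rw [norm_mul]; simp; linarith)
    have e2 := ih x (by linarith)
    simp only [T] at *
    rw [← e2, ← e1]; congr 1; push_cast; ring

lemma inv_neg {f : ℂ → ZMod 3} {R τ : ℝ} {p : ℂ} (h : EqB R (T p f) f) (hp : ‖p‖ ≤ τ) :
    EqB (R - τ) (T (-p) f) f := by
  have := h.T (s := -p) (τ := τ) (by rwa [norm_neg])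
  intro x hx
  have := this x hx
  simp only [T, neg_add_cancel_right] at *
  exact this.symm

/-- if the second difference vanishes, the function is invariant under the triple step -/
lemma triple {f : ℂ → ZMod 3} {R τ : ℝ} {p : ℂ} (h : EqB R (T p (dl p f)) (dl p f))
    (hp : ‖p‖ ≤ τ) : EqB (R - 2 * τ) (T (3 * p) f) f := by
  intro x hx
  have h0 := norm_nonneg p
  have hp2 : ‖p / 2‖ = ‖p‖ / 2 := by simp
  have e1 := h (x + p / 2) (by
    refine (norm_add_le _ _).trans_lt ?_
    linarith)
  have e2 := h (x + p / 2 + p) (by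
    refine (norm_add_le _ _).trans_lt ?_
    have := norm_add_le x (p / 2)
    linarith)
  simp only [T, dl] at *
  have a1 : x + p / 2 + p + p / 2 = x + p + p := by ring
  have a2 : x + p / 2 + p - p / 2 = x + p := by ring
  have a3 : x + p / 2 + p / 2 = x + p := by ring
  have a4 : x + p / 2 - p / 2 = x := by ring
  have a5 : x + p / 2 + p + p + p / 2 = x + 3 * p := by ring
  have a6 : x + p / 2 + p + p - p / 2 = x + p + p := by ring
  rw [a1, a2, a3, a4] at e1
  rw [a5, a6, a1, a2] at e2
  linear_combination e2 + 2 * e1 + (f (x + p) - f x) * three0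

lemma unitpair {e : ℂ} {l : ℝ} (he : ‖e‖ = 1) (h0 : 0 ≤ l) (h1 : l ≤ 1) :
    ∃ u v : ℂ, ‖u‖ = 1 ∧ ‖v‖ = 1 ∧ ‖u - 1‖ ≤ ‖e - 1‖ + l ∧ ‖v - 1‖ ≤ ‖e - 1‖ + l ∧
      u - v = Complex.I * l * e := by
  have hb := rr_bounds h0 h1
  have hsq := rr_sq h0 h1
  have unit : ∀ s : ℝ, s ^ 2 = l ^ 2 / 4 → ‖e * (rr l + Complex.I * s)‖ = 1 := by
    intro s hs
    rw [norm_mul, he, one_mul, Complex.norm_def, Complex.normSq_apply]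
    simp only [Complex.add_re, Complex.add_im, Complex.ofReal_re, Complex.ofReal_im,
      Complex.mul_re, Complex.mul_im, Complex.I_re, Complex.I_im]
    rw [Real.sqrt_eq_one]
    nlinarith
  have n1 : ‖(rr l : ℂ) - 1‖ ≤ l / 4 := by
    rw [← Complex.ofReal_one, ← Complex.ofReal_sub, Complex.norm_real, Real.norm_eq_abs, abs_le]
    constructor <;> nlinarith
  have near : ∀ s : ℝ, |s| = l / 2 → ‖e * (rr l + Complex.I * s) - 1‖ ≤ ‖e - 1‖ + l := by
    intro s hs
    have : e * (rr l + Complex.I * s) - 1 = (e - 1) + e * ((rr l - 1) + Complex.I * s) := by ring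
    rw [this]
    refine (norm_add_le _ _).trans ?_
    rw [norm_mul, he, one_mul]
    have := norm_add_le ((rr l : ℂ) - 1) (Complex.I * s)
    have h2 : ‖Complex.I * (s : ℂ)‖ = l / 2 := by simp [hs]
    linarith
  refine ⟨_, _, unit (l / 2) (by ring), unit (-(l / 2)) (by ring), near _ ?_, near _ ?_, ?_⟩
  · rw [abs_of_nonneg (by linarith)]
  · rw [abs_neg, abs_of_nonneg (by linarith)]
  · push_cast; ring

lemma dl_negstep (a : ℂ) (f) : dl (-a) f = - dl a f := by
  funext x; simp only [dl, Pi.neg_apply]; ring_nf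

lemma om_cube : om ^ 3 = -1 := by
  have := om_sq
  linear_combination (om + 1) * this

/-- mixed differences vanish -/
lemma mixed {A B C : ℂ → ZMod 3} {ρ τ l : ℝ} {N : ℕ} {e : ℂ}
    (hABC : Rel A B C 1 ρ) (hCAB : Rel C A B (-om) ρ) (hBCA : Rel B C A (om ^ 2) ρ)
    (hτ0 : 0 < τ) (hτρ : 100 * τ ≤ ρ) (hτ1 : τ ≤ 1)
    (hl0 : 0 < l) (hl : 27 * l ≤ τ / 2) (hN : N * (√3 * eta l) = 9 * l) (heta : 0 < eta l)
    (he : ‖e‖ = 1) (he1 : ‖e - 1‖ ≤ τ / 2)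
    {e' : ℂ} {l' : ℝ} (he' : ‖e'‖ = 1) (he1' : ‖e' - 1‖ ≤ τ / 2) (hl0' : 0 ≤ l')
    (hl' : l' ≤ τ / 2) :
    EqB (ρ - 60 * τ) (T (27 * (Complex.I * l * e)) (dl (om ^ 2 * (Complex.I * l' * e')) B))
      (dl (om ^ 2 * (Complex.I * l' * e')) B) := by
  have hτρ' : τ < ρ := by linarith
  obtain ⟨E, hs⟩ := chord hCAB (by simp [om_norm]) he' he1' hl0' hl' (by linarith) hτρ'
  have I1 := (inv hABC (by simp) he he1 hl0.le (by linarith) (by linarith) hτρ').2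
  have I2 := (inv hBCA (by simp [om_norm]) he he1 hl0.le (by linarith) (by linarith) hτρ').1
  have hs' : ‖(-om) * om ^ 2 * (e' * rr l' - 1)‖ ≤ τ := by simpa [om_norm] using hs
  generalize (-om) * om ^ 2 * (e' * rr l' - 1) = s' at E hs'
  have ea : om * (-om * (Complex.I * l' * e')) = -(om ^ 2 * (Complex.I * l' * e')) := by ring
  rw [ea, dl_negstep, T_neg, neg_neg] at E
  have na : ‖om ^ 2 * (Complex.I * l' * e')‖ ≤ τ := by
    simp [om_norm, he', abs_of_nonneg hl0']; linarith
  have nb : ‖-om * (Complex.I * l' * e')‖ ≤ τ := by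
    simp [om_norm, he', abs_of_nonneg hl0']; linarith
  generalize om ^ 2 * (Complex.I * l' * e') = a at E na ⊢
  generalize -om * (Complex.I * l' * e') = b at E nb
  simp only [one_mul] at I1
  have eD : 9 * (om * (om ^ 2 * (Complex.I * l * e))) = -(9 * (Complex.I * l * e)) := by
    linear_combination 9 * (Complex.I * l * e) * om_cube
  rw [eD, dl_negstep, T_neg] at I2
  have I2 := I2.neg
  rw [neg_neg, neg_neg] at I2
  have nD : ‖9 * (Complex.I * l * e)‖ ≤ τ := by
    simp [he, abs_of_nonneg hl0.le]; linarith
  have e27 : 27 * (Complex.I * l * e) = 3 * (9 * (Complex.I * l * e)) := by ring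
  rw [e27]
  have hp : -(om ^ 2 * om ^ 2 * e * eta l) - -(om ^ 2 * e * eta l)
      = Complex.I * (√3 : ℝ) * e * eta l := by
    rw [← om_add]
    linear_combination (-om * e * eta l) * om_cube
  have hNp : N * (Complex.I * (√3 : ℝ) * e * eta l) = 9 * (Complex.I * l * e) := by
    have : ((N * (√3 * eta l) : ℝ) : ℂ) = ((9 * l : ℝ) : ℂ) := by rw [hN]
    push_cast at this
    linear_combination Complex.I * e * this
  have hNpn : N * ‖Complex.I * (√3 : ℝ) * e * eta l‖ ≤ τ := by
    have := congrArg norm hNp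
    rw [norm_mul, Complex.norm_natCast] at this
    rw [this]; exact nD
  have hsq3 : 1 ≤ √3 := Real.one_le_sqrt.mpr (by norm_num)
  have hetaτ : eta l ≤ τ := by
    have hN1 : (1 : ℝ) ≤ N := by
      rcases Nat.eq_zero_or_pos N with h | h
      · subst h; simp at hN; linarith
      · exact_mod_cast h
    have : 1 * (1 * eta l) ≤ N * (√3 * eta l) := by gcongr
    linarith
  have n1 : ‖-(om ^ 2 * e * eta l)‖ ≤ τ := by
    simpa [om_norm, he, abs_of_pos heta] using hetaτ
  have n2 : ‖-(om ^ 2 * om ^ 2 * e * eta l)‖ ≤ τ := by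
    simpa [om_norm, he, abs_of_pos heta] using hetaτ
  generalize Complex.I * (√3 : ℝ) * e * eta l = p at hp hNp hNpn
  generalize 9 * (Complex.I * l * e) = D at *
  generalize -(om ^ 2 * e * eta l) = w1 at *
  generalize -(om ^ 2 * om ^ 2 * e * eta l) = w2 at *
  -- first invariance
  have J1 := I1.dl na
  rw [← T_dl, dl_dl] at J1
  -- second invariance
  have J2 := I2.dl nb
  rw [← T_dl, dl_dl] at J2
  have F := E.dl nD
  have F2 := F.T n2
  rw [← T_dl] at F F2
  have J3 := ((F2.symm.mono (by linarith : ρ - 45 * τ ≤ _)).trans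
    (J2.mono (by linarith))).trans (F.mono (by linarith))
  have J4 := J3.T (s := -s') (τ := τ) (by rwa [norm_neg])
  simp only [T_T] at J4
  rw [show -s' + (w2 + s') = w2 by ring, show -s' + s' = 0 by ring] at J4
  have T0 : ∀ f, T 0 f = f := fun f => by funext x; simp [T]
  rw [T0] at J4
  have J5 := (inv_neg J1 n1).T n2
  rw [T_T] at J5
  have J6 := (J5.mono (by linarith : ρ - 50 * τ ≤ _)).trans (J4.mono (by linarith))
  rw [← sub_eq_add_neg, hp] at J6
  have J7 := iter J6 N
  rw [hNp] at J7
  exact (triple J7 nD).mono (by linarith)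

lemma conclude {A B C : ℂ → ZMod 3} {R : ℝ} (hR : 0 < R) (h : Rel A B C 1 R) :
    ∃ σ > 0, ∀ x, ‖x‖ < σ → B x = B 0 := by
  set ρ := R / 2 with hρ
  have hρ0 : 0 < ρ := by positivity
  have hABC : Rel A B C 1 ρ := fun x hx u hu hu1 => h x (by linarith) u hu (by linarith)
  have hCAB : Rel C A B (-om) ρ := by
    intro x hx u hu hu1
    have := h (x - om * (u - 1)) (by
      refine (norm_sub_le _ _).trans_lt ?_
      rw [norm_mul, om_norm]; linarith) u hu (by linarith)
    have e1 : x - om * (u - 1) + 1 * (u - 1) = x + -om * om * (u - 1) := by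
      linear_combination (u - 1) * om_sq
    have e2 : x - om * (u - 1) + 1 * om * (u - 1) = x := by ring
    have e3 : x - om * (u - 1) = x + -om * (u - 1) := by ring
    rw [e1, e2, e3] at this
    linear_combination this
  have hBCA : Rel B C A (om ^ 2) ρ := by
    intro x hx u hu hu1
    have := h (x - (u - 1)) (by
      refine (norm_sub_le _ _).trans_lt ?_
      linarith) u hu (by linarith)
    have e1 : x - (u - 1) + 1 * (u - 1) = x := by ring
    have e2 : x - (u - 1) + 1 * om * (u - 1) = x + om ^ 2 * (u - 1) := by
      linear_combination -(u - 1) * om_sq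
    have e3 : x - (u - 1) = x + om ^ 2 * om * (u - 1) := by
      linear_combination -(u - 1) * om_cube
    rw [e1, e2, e3] at this
    linear_combination this
  set τ := min (ρ / 200) 1 with hτ
  have hτ0 : 0 < τ := by positivity
  have hτρ : τ ≤ ρ / 200 := min_le_left _ _
  have hτ1 : τ ≤ 1 := min_le_right _ _
  obtain ⟨σ, hσ, hcone⟩ := cone (τ := τ / 2) (by positivity)
  obtain ⟨l, hl0, hl, N, hN, heta⟩ := special (τ := min (τ / 200) (σ / 28)) (by positivity)
  have hla : l < τ / 200 := lt_of_lt_of_le hl (min_le_left _ _)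
  have hlb : l < σ / 28 := lt_of_lt_of_le hl (min_le_right _ _)
  have main : ∀ e : ℂ, ‖e‖ = 1 → ‖e - 1‖ ≤ τ / 2 →
      EqB (ρ - 80 * τ) (T (81 * (Complex.I * l * e)) B) B := by
    intro e he he1
    set D := 27 * (Complex.I * l * e) with hD
    have nD : ‖D‖ ≤ τ := by
      simp [hD, he, abs_of_nonneg hl0.le]; linarith
    have hh : ∀ (e' : ℂ) (l' : ℝ), ‖e'‖ = 1 → ‖e' - 1‖ ≤ τ / 2 → 0 ≤ l' → l' ≤ τ / 2 →
        EqB (ρ - 62 * τ) (T (om ^ 2 * (Complex.I * l' * e')) (dl D B)) (dl D B) := by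
      intro e' l' h1 h2 h3 h4
      have M := mixed (N := N) hABC hCAB hBCA hτ0 (by linarith) hτ1 hl0 (by linarith) hN heta
        he he1 h1 h2 h3 h4
      have na : ‖om ^ 2 * (Complex.I * l' * e')‖ ≤ τ := by
        simp [om_norm, h1, abs_of_nonneg h3]; linarith
      rw [← hD] at M
      generalize om ^ 2 * (Complex.I * l' * e') = a at *
      intro x hx
      have nt : ‖a / 2 - D / 2‖ ≤ τ := by
        refine (norm_sub_le _ _).trans ?_
        simp only [norm_div, Complex.norm_ofNat]; linarith
      have := M (x + (a / 2 - D / 2)) (by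
        refine (norm_add_le _ _).trans_lt ?_
        linarith)
      simp only [T, dl] at this ⊢
      have b1 : x + (a / 2 - D / 2) + D + a / 2 = x + a + D / 2 := by ring
      have b2 : x + (a / 2 - D / 2) + D - a / 2 = x + D / 2 := by ring
      have b3 : x + (a / 2 - D / 2) + a / 2 = x + a - D / 2 := by ring
      have b4 : x + (a / 2 - D / 2) - a / 2 = x - D / 2 := by ring
      rw [b1, b2, b3, b4] at this
      linear_combination this
    obtain ⟨l1, l2, e1, e2, p1, p2, p3, p4, p5, p6, p7, p8, hz⟩ := hcone (27 * l * e * om) (by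
      simp [om_norm, he, abs_of_nonneg hl0.le]; linarith)
    have H1 := hh e1 l1 p5 (by linarith) p1 (by linarith)
    have H2 := hh e2 l2 p6 (by linarith) p3 (by linarith)
    have n1 : ‖om ^ 2 * (Complex.I * l1 * e1)‖ ≤ τ := by
      simp [om_norm, p5, abs_of_nonneg p1]; linarith
    have n2 : ‖om ^ 2 * (Complex.I * l2 * e2)‖ ≤ τ := by
      simp [om_norm, p6, abs_of_nonneg p3]; linarith
    have H3 := (inv_neg H1 n1).T n2
    rw [T_T] at H3
    have H4 := (H3.mono (by linarith : ρ - 66 * τ ≤ _)).trans (H2.mono (by linarith))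
    have hs : om ^ 2 * (Complex.I * l2 * e2) + -(om ^ 2 * (Complex.I * l1 * e1)) = D := by
      rw [hD]
      linear_combination (om ^ 2 * Complex.I) * hz - 27 * Complex.I * l * e * om_cube
    rw [hs] at H4
    have := triple H4 nD
    rw [show 3 * D = 81 * (Complex.I * l * e) by rw [hD]; ring] at this
    exact this.mono (by linarith)
  obtain ⟨σ', hσ', hcone'⟩ := cone (τ := τ / 4) (by positivity)
  have main2 : ∀ (e : ℂ) (l' : ℝ), ‖e‖ = 1 → ‖e - 1‖ ≤ τ / 4 → 0 ≤ l' → l' ≤ τ / 4 →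
      EqB (ρ - 82 * τ) (T (-(81 * l * (l' * e))) B) B := by
    intro e l' h1 h2 h3 h4
    obtain ⟨u, v, hu, hv, hu1, hv1, huv⟩ := unitpair h1 h3 (by linarith)
    have U := main u hu (by linarith)
    have V := main v hv (by linarith)
    have nu : ‖81 * (Complex.I * l * u)‖ ≤ τ := by
      simp [hu, abs_of_nonneg hl0.le]; linarith
    have nv : ‖81 * (Complex.I * l * v)‖ ≤ τ := by
      simp [hv, abs_of_nonneg hl0.le]; linarith
    have W := (inv_neg V nv).T nu
    rw [T_T] at W
    have W2 := (W.mono (by linarith : ρ - 82 * τ ≤ _)).trans (U.mono (by linarith))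
    have : 81 * (Complex.I * l * u) + -(81 * (Complex.I * l * v)) = -(81 * l * (l' * e)) := by
      linear_combination 81 * Complex.I * l * huv + 81 * l * l' * e * Complex.I_sq
    rwa [this] at W2
  refine ⟨81 * l * σ', by positivity, fun x hx => ?_⟩
  have hlc : (l : ℂ) ≠ 0 := by exact_mod_cast hl0.ne'
  obtain ⟨l1, l2, e1, e2, p1, p2, p3, p4, p5, p6, p7, p8, hz⟩ := hcone' (x / (81 * l)) (by
    simp only [norm_div, norm_mul, Complex.norm_ofNat, Complex.norm_real, Real.norm_eq_abs,
      abs_of_pos hl0]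
    rw [div_lt_iff₀ (by positivity)]; linarith)
  have H1 := main2 e1 l1 p5 p7 p1 p2
  have H2 := main2 e2 l2 p6 p8 p3 p4
  have n1 : ‖-(81 * (l : ℂ) * (l1 * e1))‖ ≤ τ := by
    simp only [norm_neg, norm_mul, Complex.norm_ofNat, Complex.norm_real, Real.norm_eq_abs,
      abs_of_pos hl0, abs_of_nonneg p1, p5]
    nlinarith
  have n2 : ‖-(81 * (l : ℂ) * (l2 * e2))‖ ≤ τ := by
    simp only [norm_neg, norm_mul, Complex.norm_ofNat, Complex.norm_real, Real.norm_eq_abs,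
      abs_of_pos hl0, abs_of_nonneg p3, p6]
    nlinarith
  have H3 := (inv_neg H1 n1).T n2
  rw [T_T] at H3
  have H4 := (H3.mono (by linarith : ρ - 90 * τ ≤ _)).trans (H2.mono (by linarith))
  have := H4 0 (by rw [norm_zero]; linarith)
  simp only [T] at this
  rw [← this]
  congr 1
  rw [div_eq_iff (by simpa using hlc)] at hz
  linear_combination hz

lemma sum_zero : ∀ a b c : ZMod 3, a ≠ b → a ≠ c → b ≠ c → a + b + c = 0 := by decide

/-- local constancy for a positively oriented triangle -/
lemma local_const {R : Set ℂ} {c : ℂ → Fin 3}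
    (hproper : ∀ p ∈ R, ∀ q ∈ R, ‖p - q‖ = 1 → c p ≠ c q)
    {a u : ℂ} (hu : ‖u‖ = 1) (ha : a ∈ interior R) (hb : a + u ∈ interior R)
    (hc : a + om * u ∈ interior R) :
    ∃ σ > 0, ∀ x, ‖x - (a + u)‖ < σ → c x = c (a + u) := by
  have get : ∀ p ∈ interior R, ∃ ε > 0, ∀ x, ‖x - p‖ < ε → x ∈ R := by
    intro p hp
    obtain ⟨ε, hε, H⟩ := Metric.mem_nhds_iff.mp (mem_interior_iff_mem_nhds.mp hp)
    exact ⟨ε, hε, fun x hx => H (by rwa [Metric.mem_ball, dist_eq_norm])⟩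
  obtain ⟨ε1, h1, H1⟩ := get _ ha
  obtain ⟨ε2, h2, H2⟩ := get _ hb
  obtain ⟨ε3, h3, H3⟩ := get _ hc
  set ε := min ε1 (min ε2 ε3) with hε
  have hε0 : 0 < ε := by positivity
  have q1 : ε ≤ ε1 := min_le_left _ _
  have q2 : ε ≤ ε2 := (min_le_right _ _).trans (min_le_left _ _)
  have q3 : ε ≤ ε3 := (min_le_right _ _).trans (min_le_right _ _)
  have rel : Rel (fun x => (c (a + u * x) : ZMod 3)) (fun x => (c (a + u * (1 + x)) : ZMod 3))
      (fun x => (c (a + u * (om + x)) : ZMod 3)) 1 (ε / 2) := by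
    intro x hx v hv hv1
    have m1 : a + u * x ∈ R := H1 _ (by
      rw [add_sub_cancel_left, norm_mul, hu]; linarith)
    have m2 : a + u * (1 + (x + 1 * (v - 1))) ∈ R := H2 _ (by
      rw [show a + u * (1 + (x + 1 * (v - 1))) - (a + u) = u * (x + (v - 1)) by ring,
        norm_mul, hu]
      have := norm_add_le x (v - 1); linarith)
    have m3 : a + u * (om + (x + 1 * om * (v - 1))) ∈ R := H3 _ (by
      rw [show a + u * (om + (x + 1 * om * (v - 1))) - (a + om * u) = u * (x + om * (v - 1)) by ring,
        norm_mul, hu]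
      have := norm_add_le x (om * (v - 1))
      rw [norm_mul om, om_norm] at this; linarith)
    apply sum_zero
    · apply hproper _ m1 _ m2
      rw [show a + u * x - (a + u * (1 + (x + 1 * (v - 1)))) = -(u * v) by ring]
      simp [hu, hv]
    · apply hproper _ m1 _ m3
      rw [show a + u * x - (a + u * (om + (x + 1 * om * (v - 1)))) = -(u * om * v) by ring]
      simp [hu, hv, om_norm]
    · apply hproper _ m2 _ m3
      rw [show a + u * (1 + (x + 1 * (v - 1))) - (a + u * (om + (x + 1 * om * (v - 1))))
        = -(u * om ^ 2 * v) by linear_combination u * v * om_sq]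
      simp [hu, hv, om_norm]
  obtain ⟨σ, hσ, H⟩ := conclude (by positivity) rel
  have hu0 : u ≠ 0 := by rintro rfl; simp at hu
  refine ⟨σ, hσ, fun x hx => ?_⟩
  have := H ((x - (a + u)) / u) (by rw [norm_div, hu, div_one]; exact hx)
  rw [show a + u * (1 + (x - (a + u)) / u) = x by field_simp; ring,
    show a + u * (1 + 0) = a + u by ring] at this
  exact this

lemma third {t : ℂ} (h1 : ‖t‖ = 1) (h2 : ‖t - 1‖ = 1) : t = om ∨ t = 1 - om := by
  have h : √3 * √3 = 3 := Real.mul_self_sqrt (by norm_num)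
  have a1 := Complex.sq_norm t
  have a2 := Complex.sq_norm (t - 1)
  rw [h1, Complex.normSq_apply] at a1
  rw [h2, Complex.normSq_apply] at a2
  simp only [Complex.sub_re, Complex.sub_im, Complex.one_re, Complex.one_im] at a2
  have hre : t.re = 1 / 2 := by nlinarith
  have him : (t.im - √3 / 2) * (t.im + √3 / 2) = 0 := by rw [hre] at a1; nlinarith
  rcases mul_eq_zero.mp him with h' | h'
  · left; apply Complex.ext
    · simp [om, hre]
    · simp only [om]; linarith
  · right; apply Complex.ext
    · simp [om, hre]; norm_num
    · simp only [om, Complex.sub_im, Complex.one_im]; linarith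

lemma local_const' {R : Set ℂ} {c : ℂ → Fin 3}
    (hproper : ∀ p ∈ R, ∀ q ∈ R, ‖p - q‖ = 1 → c p ≠ c q)
    {p0 p1 p2 : ℂ} (h0 : p0 ∈ interior R) (h1 : p1 ∈ interior R) (h2 : p2 ∈ interior R)
    (h01 : ‖p0 - p1‖ = 1) (h02 : ‖p0 - p2‖ = 1) (h21 : ‖p2 - p1‖ = 1) :
    ∃ σ > 0, ∀ x, ‖x - p0‖ < σ → c x = c p0 := by
  have hu0 : p0 - p1 ≠ 0 := by intro h; rw [h] at h01; simp at h01
  have ht := third (t := (p2 - p1) / (p0 - p1)) (by rw [norm_div, h01, h21, div_one]) (by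
    rw [div_sub_one hu0, norm_div, h01, div_one, ← h02, ← norm_neg]; congr 1; ring)
  rw [div_eq_iff hu0, div_eq_iff hu0] at ht
  rcases ht with ht | ht
  · have := local_const hproper (a := p1) (u := p0 - p1) h01 h1 (by simpa using h0) (by
      rw [← ht]; simpa using h2)
    simpa using this
  · have := local_const hproper (a := p2) (u := p0 - p2) h02 h2 (by simpa using h0) (by
      rw [show p2 + om * (p0 - p2) = p1 by
        linear_combination (1 - om) * ht + (p0 - p1) * om_sq]; exact h1)
    simpa using this

end TriRod

theorem tri_rod_lemma (R : Set ℂ) (c : ℂ → Fin 3)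
    (hproper : ∀ p ∈ R, ∀ q ∈ R, ‖p - q‖ = 1 → c p ≠ c q)
    (γ : Fin 3 → ℝ → ℂ)
    (hcont : ∀ i, ContinuousOn (γ i) (Set.Icc 0 1))
    (hR : ∀ i, ∀ t ∈ Set.Icc (0 : ℝ) 1, γ i t ∈ interior R)
    (hrod : ∀ i j, i ≠ j → ∀ t ∈ Set.Icc (0 : ℝ) 1, ‖γ i t - γ j t‖ = 1) :
    c (γ 0 0) = c (γ 0 1) := by
  have hc : ContinuousOn (fun t => c (γ 0 t)) (Set.Icc 0 1) := by
    intro t ht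
    obtain ⟨σ, hσ, H⟩ := TriRod.local_const' hproper (hR 0 t ht) (hR 1 t ht) (hR 2 t ht)
      (hrod 0 1 (by decide) t ht) (hrod 0 2 (by decide) t ht) (hrod 2 1 (by decide) t ht)
    have hc0 : ContinuousAt c (γ 0 t) := by
      apply (continuousAt_const (y := c (γ 0 t))).congr
      rw [Filter.EventuallyEq, Metric.eventually_nhds_iff]
      exact ⟨σ, hσ, fun y hy => (H y (by rwa [← dist_eq_norm])).symm⟩
    exact hc0.comp_continuousWithinAt (hcont 0 t ht)
  exact isPreconnected_Icc.constant hc (by simp) (by simp)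
end

section
/- For 0 < r < 1/2, the radial chromatic number of A_r equals ⌈2π/θ⌉, where θ = arccos(1 - 1/(2(1/2 + r)²)); i.e., the minimum number of colors in a proper radial coloring of A_r is the least N such that N unit-chord steps suffice to walk around the outer circle. -/
/-- A coloring of the plane is *radial* if, away from the origin, it depends only on the
argument, and there are finitely many boundary angles such that the coloring is constant on
each open arc of angles avoiding them (boundary rays may be colored arbitrarily). -/
def IsRadial {α : Type*} (c : ℂ → α) : Prop :=
  ∃ (s : Finset ℝ) (f : ℝ → α),
    (∀ p : ℂ, p ≠ 0 → c p = f p.arg) ∧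
    ∀ a b : ℝ, (∀ i ∈ s, i ∉ Set.Ioo a b) →
      ∀ x ∈ Set.Ioo a b, ∀ y ∈ Set.Ioo a b, f x = f y

/-- Combinatorial core: independence number of the circular clique. -/
lemma circ_core (M q : ℕ) (hM : 2 ≤ M) (hq : 1 ≤ q) (g : ℕ → Fin M)
    (hg : ∀ i k : ℕ, q ≤ k → k ≤ (M * q + 1) - q → g i ≠ g (i + k)) : False := by
  have h2 : 2 * q ≤ M * q := Nat.mul_le_mul_right q hM
  obtain ⟨y, -, hy⟩ := Finset.exists_lt_card_fiber_of_mul_lt_card_of_maps_to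
    (s := Finset.range (M * q + 1)) (t := (Finset.univ : Finset (Fin M))) (f := g) (n := q)
    (fun a _ => Finset.mem_univ _) (by simp)
  generalize hp : M * q + 1 = p at *
  set S := (Finset.range p).filter (fun x => g x = y) with hS
  have hne : S.Nonempty := Finset.card_pos.mp (by omega)
  set a := S.min' hne with ha
  have haS : a ∈ S := Finset.min'_mem _ _
  have hmin : ∀ x ∈ S, a ≤ x := fun x hx => Finset.min'_le _ _ hx
  have key : ∀ x ∈ S, ∀ z ∈ S, x ≤ z → q ≤ z - x → z - x ≤ p - q → False := by
    intro x hx z hz hxz h1 h2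
    have := hg x (z - x) h1 h2
    rw [Nat.add_sub_cancel' hxz] at this
    simp only [hS, Finset.mem_filter] at hx hz
    exact this (hx.2.trans hz.2.symm)
  have hlt : ∀ x ∈ S, x < p := by
    intro x hx
    simp only [hS, Finset.mem_filter, Finset.mem_range] at hx
    exact hx.1
  have hcase : ∀ x ∈ S, x - a < q ∨ p - q < x - a := by
    intro x hx
    by_contra! hcon
    exact key a haS x hx (hmin x hx) hcon.1 hcon.2
  have hle : S.card ≤ (Finset.range q).card := by
    apply Finset.card_le_card_of_injOn (fun x => if x - a < q then x - a else x - a - (p - q))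
    · intro x hx
      have := hlt x hx
      have := hmin x hx
      rcases hcase x hx with h | h
      · simp [h]
      · have h' : ¬ (x - a < q) := by omega
        simp only [h', if_false, Finset.coe_range, Set.mem_Iio]
        omega
    · intro x hx z hz hxz
      have h1 := hmin x hx
      have h2 := hmin z hz
      have h3 := key x hx z hz
      have h4 := key z hz x hx
      have h5 := hcase x hx
      have h6 := hcase z hz
      simp only at hxz
      split_ifs at hxz <;> by_contra hne <;> first | omega | (apply h3 <;> omega) | (apply h4 <;> omega)
  simp at hle
  omega

lemma sin_half {R : ℝ} (h1 : 1 / 2 < R) :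
    Real.sin (Real.arccos (1 - 1 / (2 * R ^ 2)) / 2) = 1 / (2 * R) := by
  have hR : 0 < R := by linarith
  have hb : 1 / (2 * R ^ 2) ≤ 2 := by
    rw [div_le_iff₀ (by positivity)]; nlinarith
  have hb0 : 0 ≤ 1 / (2 * R ^ 2) := by positivity
  rw [Real.sin_half_eq_sqrt (Real.arccos_nonneg _)
    (by linarith [Real.arccos_le_pi (1 - 1 / (2 * R ^ 2)), Real.pi_pos]),
    Real.cos_arccos (by linarith) (by linarith)]
  rw [Real.sqrt_eq_iff_mul_self_eq (by linarith) (by positivity)]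
  field_simp
  ring

lemma theta_pos {R : ℝ} (h1 : 1 / 2 < R) : 0 < Real.arccos (1 - 1 / (2 * R ^ 2)) := by
  have hR : 0 < R := by linarith
  rw [Real.arccos_pos]
  have : 0 < 1 / (2 * R ^ 2) := by positivity
  linarith

lemma theta_lt_pi {R : ℝ} (h1 : 1 / 2 < R) : Real.arccos (1 - 1 / (2 * R ^ 2)) < Real.pi := by
  have hR : 0 < R := by linarith
  have hb : 1 / (2 * R ^ 2) < 2 := by
    rw [div_lt_iff₀ (by positivity)]; nlinarith
  refine lt_of_le_of_ne (Real.arccos_le_pi _) ?_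
  rw [Ne, Real.arccos_eq_pi]
  linarith

lemma arg_ray (ρ x : ℝ) (hρ : 0 < ρ) :
    ((ρ : ℂ) * Complex.exp (x * Complex.I)).arg = (Complex.exp (x * Complex.I)).arg :=
  Complex.arg_real_mul _ hρ

lemma norm_exp_sub (x φ : ℝ) (h0 : 0 ≤ φ) (h1 : φ ≤ 2 * Real.pi) :
    ‖Complex.exp (x * Complex.I) - Complex.exp ((x + φ : ℝ) * Complex.I)‖
      = 2 * Real.sin (φ / 2) := by
  have hs : 0 ≤ Real.sin (φ / 2) :=
    Real.sin_nonneg_of_nonneg_of_le_pi (by linarith) (by linarith)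
  rw [← sq_eq_sq₀ (norm_nonneg _) (by positivity), Complex.sq_norm, Complex.normSq_apply]
  simp only [Complex.sub_re, Complex.sub_im, Complex.exp_ofReal_mul_I_re,
    Complex.exp_ofReal_mul_I_im, Real.cos_add, Real.sin_add]
  have e1 : Real.cos φ = 1 - 2 * Real.sin (φ / 2) ^ 2 := by
    have h1 := Real.cos_two_mul (φ / 2)
    have h2 := Real.sin_sq_add_cos_sq (φ / 2)
    rw [mul_div_cancel₀ φ two_ne_zero] at h1
    linarith
  have e2 := Real.sin_sq_add_cos_sq φ
  have e3 := Real.sin_sq_add_cos_sq x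
  have : (Real.cos x - (Real.cos x * Real.cos φ - Real.sin x * Real.sin φ)) *
      (Real.cos x - (Real.cos x * Real.cos φ - Real.sin x * Real.sin φ)) +
      (Real.sin x - (Real.sin x * Real.cos φ + Real.cos x * Real.sin φ)) *
      (Real.sin x - (Real.sin x * Real.cos φ + Real.cos x * Real.sin φ))
      = (Real.sin x ^ 2 + Real.cos x ^ 2) *
        (1 - 2 * Real.cos φ + (Real.sin φ ^ 2 + Real.cos φ ^ 2)) := by ring
  rw [this, e3, e2, e1]; ring

lemma norm_sub_sq_polar (p q : ℂ) :
    ‖p - q‖ ^ 2 = ‖p‖ ^ 2 + ‖q‖ ^ 2 - 2 * ‖p‖ * ‖q‖ * Real.cos (p.arg - q.arg) := by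
  have hp := Complex.sq_norm p
  have hq := Complex.sq_norm q
  rw [Complex.normSq_apply] at hp hq
  have h : 2 * ‖p‖ * ‖q‖ * Real.cos (p.arg - q.arg) = 2 * (p.re * q.re + p.im * q.im) := by
    rw [Real.cos_sub]
    calc _ = 2 * ((‖p‖ * Real.cos p.arg) * (‖q‖ * Real.cos q.arg)
          + (‖p‖ * Real.sin p.arg) * (‖q‖ * Real.sin q.arg)) := by ring
      _ = _ := by simp only [Complex.norm_mul_cos_arg, Complex.norm_mul_sin_arg]
  rw [h, hp, hq, Complex.sq_norm, Complex.normSq_apply, Complex.sub_re, Complex.sub_im]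
  ring

lemma dist_lt_one {R a b C : ℝ} (h1 : 1 / 2 < R) (h2 : R < 1) (ha : 1 - R ≤ a) (ha' : a ≤ R)
    (hb : 1 - R ≤ b) (hb' : b ≤ R) (hC : 1 - 1 / (2 * R ^ 2) < C) :
    a ^ 2 + b ^ 2 - 2 * a * b * C < 1 := by
  have hR : 0 < R := by linarith
  have hab : 0 < a * b := mul_pos (by linarith) (by linarith)
  have e : 2 * (a * b) * (1 - C) < a * b / R ^ 2 := by
    have : a * b / R ^ 2 = 2 * (a * b) * (1 / (2 * R ^ 2)) := by field_simp
    rw [this]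
    exact mul_lt_mul_of_pos_left (by linarith) (by linarith)
  have key : ∀ u v : ℝ, 1 - R ≤ u → u ≤ v → v ≤ R → R ^ 2 * (u - v) ^ 2 + u * v ≤ R ^ 2 := by
    intro u v hu huv hv
    have ht : R * (v - u) ≤ 1 := by nlinarith
    have h3 : u * v ≤ (R - (v - u)) * R :=
      mul_le_mul (by linarith) hv (by linarith) (by linarith)
    have h4 : (R * (v - u)) * (R * (v - u)) ≤ 1 * (R * (v - u)) :=
      mul_le_mul_of_nonneg_right ht (mul_nonneg hR.le (by linarith))
    nlinarith
  have k : R ^ 2 * (a - b) ^ 2 + a * b ≤ R ^ 2 := by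
    rcases le_total a b with h | h
    · exact key a b ha h hb'
    · have := key b a hb h ha'
      nlinarith
  have k2 : (a - b) ^ 2 + a * b / R ^ 2 ≤ 1 := by
    have hR2 : 0 < R ^ 2 := by positivity
    have : (a - b) ^ 2 + a * b / R ^ 2 = (R ^ 2 * (a - b) ^ 2 + a * b) / R ^ 2 := by
      field_simp
    rw [this, div_le_one hR2]
    exact k
  nlinarith

/-- The sector colouring. -/
noncomputable def sectorColor (N : ℕ) (hN : 0 < N) (x : ℝ) : Fin N :=
  ⟨min ⌊(Real.pi - x) * N / (2 * Real.pi)⌋₊ (N - 1), by omega⟩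

lemma sectorColor_const (N : ℕ) (hN : 0 < N) (a b : ℝ)
    (h : ∀ i ∈ (Finset.range N).image (fun k : ℕ => Real.pi - 2 * Real.pi * k / N),
      i ∉ Set.Ioo a b) (x y : ℝ) (hx : x ∈ Set.Ioo a b) (hy : y ∈ Set.Ioo a b) (hxy : x ≤ y) :
    sectorColor N hN x = sectorColor N hN y := by
  have hpi := Real.pi_pos
  have hN' : (0 : ℝ) < N := by exact_mod_cast hN
  have hle : ⌊(Real.pi - y) * N / (2 * Real.pi)⌋₊ ≤ ⌊(Real.pi - x) * N / (2 * Real.pi)⌋₊ := by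
    apply Nat.floor_le_floor
    gcongr
  by_contra hne
  have hne' : min ⌊(Real.pi - x) * N / (2 * Real.pi)⌋₊ (N - 1)
      ≠ min ⌊(Real.pi - y) * N / (2 * Real.pi)⌋₊ (N - 1) := fun he => hne (Fin.ext he)
  set m := min ⌊(Real.pi - x) * N / (2 * Real.pi)⌋₊ (N - 1) with hm
  have hmN : m < N := by omega
  have hm0 : m ≠ 0 := by omega
  have h1 : m ≤ ⌊(Real.pi - x) * N / (2 * Real.pi)⌋₊ := by omega
  have h2 : ⌊(Real.pi - y) * N / (2 * Real.pi)⌋₊ < m := by omega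
  rw [Nat.le_floor_iff' hm0, le_div_iff₀ (by positivity)] at h1
  rw [Nat.floor_lt' hm0, div_lt_iff₀ (by positivity)] at h2
  refine h (Real.pi - 2 * Real.pi * m / N)
    (Finset.mem_image.mpr ⟨m, Finset.mem_range.mpr hmN, rfl⟩) ⟨?_, ?_⟩
  · have : 2 * Real.pi * m / N ≤ Real.pi - x := by
      rw [div_le_iff₀ hN']; linarith
    linarith [hx.1]
  · have : Real.pi - y < 2 * Real.pi * m / N := by
      rw [lt_div_iff₀ hN']; linarith
    linarith [hy.2]

lemma sectorColor_bounds (N : ℕ) (hN : 0 < N) (x : ℝ) (h1 : -Real.pi < x) (h2 : x ≤ Real.pi) :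
    ((sectorColor N hN x : ℕ) : ℝ) ≤ (Real.pi - x) * N / (2 * Real.pi) ∧
    (Real.pi - x) * N / (2 * Real.pi) < ((sectorColor N hN x : ℕ) : ℝ) + 1 := by
  have hpi := Real.pi_pos
  have hN' : (0 : ℝ) < N := by exact_mod_cast hN
  have h0 : 0 ≤ (Real.pi - x) * N / (2 * Real.pi) :=
    div_nonneg (mul_nonneg (by linarith) hN'.le) (by linarith)
  have hlt : ⌊(Real.pi - x) * N / (2 * Real.pi)⌋₊ < N := by
    rw [Nat.floor_lt h0, div_lt_iff₀ (by positivity)]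
    nlinarith
  have he : (sectorColor N hN x : ℕ) = ⌊(Real.pi - x) * N / (2 * Real.pi)⌋₊ := by
    simp only [sectorColor]
    omega
  rw [he]
  exact ⟨Nat.floor_le h0, Nat.lt_floor_add_one _⟩

lemma sectorColor_near (N : ℕ) (hN : 0 < N) (x y : ℝ) (h1 : -Real.pi < x) (h2 : x ≤ Real.pi)
    (h3 : -Real.pi < y) (h4 : y ≤ Real.pi) (h : sectorColor N hN x = sectorColor N hN y) :
    |x - y| < 2 * Real.pi / N := by
  have hpi := Real.pi_pos
  have hN' : (0 : ℝ) < N := by exact_mod_cast hN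
  have b1 := sectorColor_bounds N hN x h1 h2
  have b2 := sectorColor_bounds N hN y h3 h4
  rw [h] at b1
  have e1 : (Real.pi - x) * N / (2 * Real.pi) < (Real.pi - y) * N / (2 * Real.pi) + 1 := by linarith
  have e2 : (Real.pi - y) * N / (2 * Real.pi) < (Real.pi - x) * N / (2 * Real.pi) + 1 := by linarith
  rw [div_add_one (by positivity), div_lt_div_iff_of_pos_right (by positivity)] at e1 e2
  rw [lt_div_iff₀ hN']
  rcases abs_cases (x - y) with ⟨ha, _⟩ | ⟨ha, _⟩ <;> rw [ha] <;> linarith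

/-- The radial chromatic number of `A_r` is `⌈2π/θ⌉`,
where `θ = arccos (1 - 1/(2(1/2 + r)²))`. -/
theorem radial_chromatic_number (r : ℝ) (hr0 : 0 < r) (hr1 : r < 1 / 2) :
    IsLeast {N : ℕ | ∃ c : ℂ → Fin N, IsRadial c ∧
        ∀ p ∈ annulus r, ∀ q ∈ annulus r, ‖p - q‖ = 1 → c p ≠ c q}
      ⌈2 * Real.pi / Real.arccos (1 - 1 / (2 * (1 / 2 + r) ^ 2))⌉₊ := by
  have hpi := Real.pi_pos
  have hR1 : 1 / 2 < 1 / 2 + r := by linarith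
  have hsin := sin_half hR1
  have hθ0 := theta_pos hR1
  have hθπ := theta_lt_pi hR1
  have hcosθ : Real.cos (Real.arccos (1 - 1 / (2 * (1 / 2 + r) ^ 2)))
      = 1 - 1 / (2 * (1 / 2 + r) ^ 2) := by
    have hb : 1 / (2 * (1 / 2 + r) ^ 2) ≤ 2 := by
      rw [div_le_iff₀ (by positivity)]; nlinarith
    have hb0 : 0 ≤ 1 / (2 * (1 / 2 + r) ^ 2) := by positivity
    exact Real.cos_arccos (by linarith) (by linarith)
  set θ := Real.arccos (1 - 1 / (2 * (1 / 2 + r) ^ 2)) with hθ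
  constructor
  · have hN : 0 < ⌈2 * Real.pi / θ⌉₊ := Nat.ceil_pos.mpr (by positivity)
    have hNθ : 2 * Real.pi / ⌈2 * Real.pi / θ⌉₊ ≤ θ := by
      have hN' : (0 : ℝ) < ⌈2 * Real.pi / θ⌉₊ := by exact_mod_cast hN
      rw [div_le_comm₀ hN' hθ0]
      exact Nat.le_ceil _
    refine ⟨fun p => sectorColor _ hN p.arg, ⟨(Finset.range ⌈2 * Real.pi / θ⌉₊).image
        (fun k : ℕ => Real.pi - 2 * Real.pi * k / ⌈2 * Real.pi / θ⌉₊),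
        sectorColor _ hN, fun _ _ => rfl, ?_⟩, ?_⟩
    · intro a b h x hx y hy
      rcases le_total x y with hxy | hxy
      · exact sectorColor_const _ hN a b h x y hx hy hxy
      · exact (sectorColor_const _ hN a b h y x hy hx hxy).symm
    · rintro p ⟨hp1, hp2⟩ q ⟨hq1, hq2⟩ hpq hc
      have hnear := sectorColor_near _ hN p.arg q.arg (Complex.neg_pi_lt_arg p)
        (Complex.arg_le_pi p) (Complex.neg_pi_lt_arg q) (Complex.arg_le_pi q) hc
      have hcos : Real.cos θ < Real.cos (p.arg - q.arg) := by
        rw [← Real.cos_abs (p.arg - q.arg)]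
        exact Real.cos_lt_cos_of_nonneg_of_le_pi (abs_nonneg _) hθπ.le (by linarith)
      rw [hcosθ] at hcos
      have := dist_lt_one hR1 (by linarith) (by linarith) hp2 (by linarith) hq2 hcos
      rw [← norm_sub_sq_polar, hpq] at this
      norm_num at this
  · rintro M ⟨c, ⟨s, f, hf, -⟩, hc⟩
    rw [Nat.ceil_le]
    by_contra! hlt
    have hconf : ∀ x φ : ℝ, θ ≤ φ → φ ≤ 2 * Real.pi - θ →
        c (Complex.exp (x * Complex.I)) ≠ c (Complex.exp ((x + φ : ℝ) * Complex.I)) := by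
      intro x φ h1 h2
      have hs : 1 / (2 * (1 / 2 + r)) ≤ Real.sin (φ / 2) := by
        rw [← hsin]
        rcases le_total (φ / 2) (Real.pi / 2) with h | h
        · exact Real.sin_le_sin_of_le_of_le_pi_div_two (by linarith) h (by linarith)
        · rw [← Real.sin_pi_sub (φ / 2)]
          exact Real.sin_le_sin_of_le_of_le_pi_div_two (by linarith) (by linarith) (by linarith)
      have hs0 : 0 < Real.sin (φ / 2) := lt_of_lt_of_le (by positivity) hs
      set ρ := 1 / (2 * Real.sin (φ / 2)) with hρ
      have hρ0 : 0 < ρ := by positivity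
      have hρ1 : 1 / 2 ≤ ρ := by
        rw [hρ, div_le_div_iff₀ (by norm_num) (by positivity)]
        linarith [Real.sin_le_one (φ / 2)]
      have hρ2 : ρ ≤ 1 / 2 + r := by
        rw [hρ, div_le_iff₀ (by positivity)]
        rw [div_le_iff₀ (by positivity)] at hs
        linarith
      have hcol : ∀ y : ℝ, c (Complex.exp (y * Complex.I))
          = c ((ρ : ℂ) * Complex.exp (y * Complex.I)) := by
        intro y
        rw [hf _ (Complex.exp_ne_zero _), hf _ (mul_ne_zero (by exact_mod_cast hρ0.ne')
          (Complex.exp_ne_zero _)), arg_ray ρ y hρ0]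
      have hnorm : ∀ y : ℝ, ‖(ρ : ℂ) * Complex.exp (y * Complex.I)‖ = ρ := by
        intro y
        rw [norm_mul, Complex.norm_exp_ofReal_mul_I, mul_one, Complex.norm_real,
          Real.norm_of_nonneg hρ0.le]
      have hmem : ∀ y : ℝ, (ρ : ℂ) * Complex.exp (y * Complex.I) ∈ annulus r := by
        intro y
        refine ⟨?_, ?_⟩ <;> rw [hnorm] <;> linarith
      rw [hcol x, hcol (x + φ)]
      apply hc _ (hmem _) _ (hmem _)
      rw [← mul_sub, norm_mul, norm_exp_sub x φ (by linarith) (by linarith), Complex.norm_real,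
        Real.norm_of_nonneg hρ0.le, hρ]
      field_simp
    -- raise the number of colours to at least two
    obtain ⟨M', hM2, hMM', hM'⟩ : ∃ M' : ℕ, 2 ≤ M' ∧ M ≤ M' ∧ (M' : ℝ) < 2 * Real.pi / θ := by
      refine ⟨max M 2, le_max_right _ _, le_max_left _ _, ?_⟩
      have : (2 : ℝ) < 2 * Real.pi / θ := by
        rw [lt_div_iff₀ hθ0]; linarith
      push_cast
      exact max_lt hlt this
    obtain ⟨n, hn⟩ := exists_nat_one_div_lt (sub_pos.mpr hM')
    have hq0 : (0 : ℝ) < n + 1 := by positivity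
    have hp0 : (0 : ℝ) < M' * (n + 1) + 1 := by positivity
    have hpq : θ * (M' * (n + 1) + 1) ≤ 2 * Real.pi * (n + 1) := by
      have h1 : (M' : ℝ) + 1 / (n + 1) ≤ 2 * Real.pi / θ := by linarith
      rw [le_div_iff₀ hθ0] at h1
      have h2 := mul_le_mul_of_nonneg_right h1 hq0.le
      have h3 : ((M' : ℝ) + 1 / (n + 1)) * θ * (n + 1) = θ * (M' * (n + 1) + 1) := by
        field_simp
      linarith
    apply circ_core M' (n + 1) hM2 (by omega)
      (fun i => Fin.castLE hMM' (c (Complex.exp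
        ((2 * Real.pi * i / (M' * (n + 1) + 1) : ℝ) * Complex.I))))
    intro i k hk1 hk2 heq
    have heq' := Fin.castLE_injective hMM' heq
    have hk2' : k + (n + 1) ≤ M' * (n + 1) + 1 := by
      have : 2 * (n + 1) ≤ M' * (n + 1) := Nat.mul_le_mul_right _ hM2
      omega
    have hk1r : ((n : ℝ) + 1) ≤ k := by exact_mod_cast hk1
    have hk2r : (k : ℝ) + (n + 1) ≤ M' * (n + 1) + 1 := by exact_mod_cast hk2'
    have g1 : θ ≤ 2 * Real.pi * (n + 1) / (M' * (n + 1) + 1) := by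
      rw [le_div_iff₀ hp0]; exact hpq
    refine hconf (2 * Real.pi * i / (M' * (n + 1) + 1)) (2 * Real.pi * k / (M' * (n + 1) + 1))
      ?_ ?_ ?_
    · refine g1.trans ?_
      gcongr
    · have : 2 * Real.pi * k / (M' * (n + 1) + 1) + 2 * Real.pi * (n + 1) / (M' * (n + 1) + 1)
          ≤ 2 * Real.pi := by
        rw [← add_div, div_le_iff₀ hp0, ← mul_add]
        gcongr
      linarith
    · rw [heq']
      congr 4
      push_cast
      ring
end
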